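/- Definitional mergeability is not transitive, hence it is not an equivalence relation. Concretely, in the language with two unary predicate symbols p and q, let T₁ = {∃!x(x=x), ∀x p(x)}, T₂ = {∃!x(x=x), ∀x ¬p(x)} and T₃ = {∃!x(x=x), ∀x q(x)} (where T₁ and T₃ are formulated with signatures {p} and {q} respectively, and T₂ with signature {p}). Then T₁ ⋈ T₃ and T₃ ⋈ T₂, but T₁ and T₂ are not definitionally mergeable. -/

import Mathlib

/-!
Formalization framework: first-order logic with equality over purely relational
signatures. A signature is a set `S : Set P` of predicate symbols, where each
symbol `p : P` has arity `ar p`. `Lang ar S` is the corresponding first-order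
language, a theory is a set of sentences of that language, and `STheory`
bundles a theory with its signature.
-/

open FirstOrder Language

namespace DefEqPaper

variable {P : Type} {ar : P → ℕ}

/-- The first-order language (purely relational) of the signature `S`. -/
def Lang (ar : P → ℕ) (S : Set P) : FirstOrder.Language where
  Functions _ := Empty
  Relations n := {p : P // p ∈ S ∧ ar p = n}

/-- A theory together with its signature. -/
structure STheory (P : Type) (ar : P → ℕ) where
  sig : Set P
  th : (Lang ar sig).Theory

/-- The inclusion of languages induced by an inclusion of signatures. -/
def langIncl {S S' : Set P} (h : S ⊆ S') : Lang ar S →ᴸ Lang ar S' where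
  onFunction _ f := f.elim
  onRelation _ r := ⟨r.1, h r.2.1, r.2.2⟩

/-- Logical equivalence: two theories of the same language having the same class
of models. -/
def TheoryEquiv {L : FirstOrder.Language} (T T' : L.Theory) : Prop :=
  ∀ (M : Type) [L.Structure M] [Nonempty M], (M ⊨ T ↔ M ⊨ T')

/-- The explicit definition `∀ x₁ … xₙ (p(x₁,…,xₙ) ↔ φ(x₁,…,xₙ))` of a relation
symbol `p ∈ S'` by a formula `φ` of the language of `S`, as a sentence of the
language of `S'`. -/
def explicitDef {S S' : Set P} (h : S ⊆ S') {p : P} (hp : p ∈ S')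
    (φ : (Lang ar S).Formula (Fin (ar p))) : (Lang ar S').Sentence :=
  (BoundedFormula.iff
    (Relations.boundedFormula (⟨p, hp, rfl⟩ : (Lang ar S').Relations (ar p))
      (fun i => Term.var (Sum.inr i)))
    (BoundedFormula.relabel Sum.inr ((langIncl h).onFormula φ))).alls

/-- `Δ` is a set consisting of one explicit definition, in terms of the language
of `S`, for each relation symbol of `S' \ S`. -/
def IsDefinitionSet {S S' : Set P} (h : S ⊆ S') (Δ : Set ((Lang ar S').Sentence)) : Prop :=
  ∃ d : (p : P) → p ∈ S' → p ∉ S → (Lang ar S).Formula (Fin (ar p)),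
    Δ = {σ | ∃ (p : P) (hp : p ∈ S') (hn : p ∉ S), σ = explicitDef h hp (d p hp hn)}

/-- `T'` is a definitional extension of `T`: the signature of `T'` contains that of
`T` and `T'` is logically equivalent to `T ∪ Δ` for a set `Δ` of explicit
definitions, in terms of the language of `T`, of the new relation symbols. -/
def DefExt (T T' : STheory P ar) : Prop :=
  ∃ h : T.sig ⊆ T'.sig, ∃ Δ : Set ((Lang ar T'.sig).Sentence),
    IsDefinitionSet h Δ ∧ TheoryEquiv ((langIncl h).onTheory T.th ∪ Δ) T'.th

/-- `T₁` and `T₂` are definitionally mergeable (Barrett–Halvorson): they have a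
common definitional extension. -/
def Mergeable (T₁ T₂ : STheory P ar) : Prop :=
  ∃ T' : STheory P ar, DefExt T₁ T' ∧ DefExt T₂ T'

/-- Definitional equivalence (Andréka–Németi): there is a finite chain of theories
connecting `T` and `T'` in which each consecutive pair is related by definitional
extension in one direction or the other. -/
def DefEquiv : STheory P ar → STheory P ar → Prop :=
  Relation.ReflTransGen (fun T T' => DefExt T T' ∨ DefExt T' T)

/-- Renaming of signatures along an arity-preserving map, as a map of languages. -/
def renameLHom {S S' : Set P} (ρ : P → P) (hmap : Set.MapsTo ρ S S')
    (har : ∀ p ∈ S, ar (ρ p) = ar p) : Lang ar S →ᴸ Lang ar S' where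
  onFunction _ f := f.elim
  onRelation _ r := ⟨ρ r.1, hmap r.2.1, (har r.1 r.2.1).trans r.2.2⟩

/-- `T'` is a disjoint renaming of `T`: their signatures are disjoint and there is
an arity-preserving bijection between the signatures under which the sentences of
`T'` are exactly the renamings of the sentences of `T`. -/
def IsDisjointRenaming (T T' : STheory P ar) : Prop :=
  Disjoint T.sig T'.sig ∧
    ∃ (ρ : P → P) (hbij : Set.BijOn ρ T.sig T'.sig)
      (har : ∀ p ∈ T.sig, ar (ρ p) = ar p),
      T'.th = (renameLHom ρ hbij.mapsTo har).onTheory T.th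

/-- The variable of a term of a purely relational language. -/
def termVar {S : Set P} {β : Type} : (Lang ar S).Term β → β
  | .var v => v
  | .func f _ => f.elim

/-- The translation of formulas induced by a map `t` sending each `n`-ary relation
symbol of the language of `S₁` to a formula of the language of `S₂` with (at most)
`n` free variables.  It maps `p(x₁,…,xₙ)` to `(t p)(x₁,…,xₙ)` and commutes with
equality and all connectives and quantifiers. -/
def trBF {S₁ S₂ : Set P} (t : ∀ n, (Lang ar S₁).Relations n → (Lang ar S₂).Formula (Fin n)) :
    ∀ {α : Type} {n : ℕ}, (Lang ar S₁).BoundedFormula α n → (Lang ar S₂).BoundedFormula α n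
  | _, _, .falsum => .falsum
  | _, _, .equal t₁ t₂ => .equal (.var (termVar t₁)) (.var (termVar t₂))
  | _, _, .rel R ts => BoundedFormula.relabel (fun i => termVar (ts i)) (t _ R)
  | _, _, .imp f g => (trBF t f).imp (trBF t g)
  | _, _, .all f => (trBF t f).all

/-- `φ` is a semantic consequence of the theory `T`. -/
def Conseq {L : FirstOrder.Language} (T : L.Theory) (φ : L.Sentence) : Prop :=
  ∀ (M : Type) [L.Structure M] [Nonempty M], M ⊨ T → M ⊨ φ

/-- The map `t` on relation symbols induces a translation of the theory `T₁` to the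
theory `T₂`: it maps consequences of `T₁` to consequences of `T₂`. -/
def IsTranslation (T₁ T₂ : STheory P ar)
    (t : ∀ n, (Lang ar T₁.sig).Relations n → (Lang ar T₂.sig).Formula (Fin n)) : Prop :=
  ∀ φ : (Lang ar T₁.sig).Sentence, Conseq T₁.th φ → Conseq T₂.th (trBF t φ)

/-- `T₁` and `T₂` are intertranslatable: there are translations `t₁₂` of `T₁` to `T₂`
and `t₂₁` of `T₂` to `T₁` such that
`T₁ ⊨ ∀ x̄ (φ(x̄) ↔ tr₂₁(tr₁₂(φ(x̄))))` for every formula `φ` of the language of `T₁`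
and `T₂ ⊨ ∀ x̄ (ψ(x̄) ↔ tr₁₂(tr₂₁(ψ(x̄))))` for every formula `ψ` of the language of `T₂`. -/
def Intertranslatable (T₁ T₂ : STheory P ar) : Prop :=
  ∃ (t₁₂ : ∀ n, (Lang ar T₁.sig).Relations n → (Lang ar T₂.sig).Formula (Fin n))
    (t₂₁ : ∀ n, (Lang ar T₂.sig).Relations n → (Lang ar T₁.sig).Formula (Fin n)),
    IsTranslation T₁ T₂ t₁₂ ∧ IsTranslation T₂ T₁ t₂₁ ∧
    (∀ (n : ℕ) (φ : (Lang ar T₁.sig).BoundedFormula Empty n),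
      Conseq T₁.th ((φ.iff (trBF t₂₁ (trBF t₁₂ φ))).alls)) ∧
    (∀ (n : ℕ) (ψ : (Lang ar T₂.sig).BoundedFormula Empty n),
      Conseq T₂.th ((ψ.iff (trBF t₁₂ (trBF t₂₁ ψ))).alls))

/-- The structure `tr*(𝔐)` induced on the underlying set of a structure `𝔐` for the
language of `S₂` by a translation-map `t`: each relation symbol `R` is interpreted by
the relation defined by the formula `t R` in `𝔐`. -/
def trStruc {S₁ S₂ : Set P} (t : ∀ n, (Lang ar S₁).Relations n → (Lang ar S₂).Formula (Fin n))
    (M : Type) (inst : (Lang ar S₂).Structure M) : (Lang ar S₁).Structure M where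
  funMap f _ := f.elim
  RelMap {n} R x := letI := inst; (t n R).Realize x

end DefEqPaper

namespace DefEqPaper

abbrev P2 : Type := Fin 2
abbrev ar2 : P2 → ℕ := fun _ => 1

/-- The signature `{p}`. -/
def sigP : Set P2 := {0}
/-- The signature `{q}`. -/
def sigQ : Set P2 := {1}

/-- The sentence `∃! x (x = x)`, i.e. `∃x (x = x ∧ ¬ ∃y (y = y ∧ ¬ x = y))`. -/
def exUnique (S : Set P2) : (Lang ar2 S).Sentence :=
  BoundedFormula.ex
    ((Term.bdEqual (Term.var (Sum.inr 0)) (Term.var (Sum.inr 0))) ⊓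
      ∼(BoundedFormula.ex
        ((Term.bdEqual (Term.var (Sum.inr 1)) (Term.var (Sum.inr 1))) ⊓
          ∼(Term.bdEqual (Term.var (Sum.inr 0)) (Term.var (Sum.inr (1 : Fin 2)))))))

/-- The sentence `∀x r(x)` for a unary relation symbol `r ∈ S`. -/
def allRel {S : Set P2} (p : P2) (hp : p ∈ S) : (Lang ar2 S).Sentence :=
  BoundedFormula.all
    (Relations.boundedFormula₁ (⟨p, hp, rfl⟩ : (Lang ar2 S).Relations 1) (Term.var (Sum.inr 0)))

/-- The sentence `∀x ¬r(x)` for a unary relation symbol `r ∈ S`. -/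
def allNotRel {S : Set P2} (p : P2) (hp : p ∈ S) : (Lang ar2 S).Sentence :=
  BoundedFormula.all
    (∼(Relations.boundedFormula₁ (⟨p, hp, rfl⟩ : (Lang ar2 S).Relations 1) (Term.var (Sum.inr 0))))

/-- `T₁ = {∃!x(x=x), ∀x p(x)}` with signature `{p}`. -/
def Th1 : STheory P2 ar2 := ⟨sigP, {exUnique sigP, allRel (S := sigP) 0 rfl}⟩

/-- `T₂ = {∃!x(x=x), ∀x ¬p(x)}` with signature `{p}`. -/
def Th2 : STheory P2 ar2 := ⟨sigP, {exUnique sigP, allNotRel (S := sigP) 0 rfl}⟩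

/-- `T₃ = {∃!x(x=x), ∀x q(x)}` with signature `{q}`. -/
def Th3 : STheory P2 ar2 := ⟨sigQ, {exUnique sigQ, allRel (S := sigQ) 1 rfl}⟩

end DefEqPaper

namespace DefEqPaper

section Realization

variable {P : Type} {ar : P → ℕ}

lemma realize_explicitDef {S S' : Set P} (h : S ⊆ S') {p : P} (hp : p ∈ S')
    (φ : (Lang ar S).Formula (Fin (ar p))) (M : Type) [(Lang ar S').Structure M] :
    M ⊨ explicitDef h hp φ ↔ ∀ x : Fin (ar p) → M,
      Structure.RelMap (L := Lang ar S') ⟨p, hp, rfl⟩ x ↔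
        ((langIncl h).onFormula φ).Realize x := by
  refine BoundedFormula.realize_alls.trans (forall_congr' fun x => ?_)
  refine BoundedFormula.realize_iff.trans (iff_congr BoundedFormula.realize_rel ?_)
  refine (BoundedFormula.realize_relabel (n := 0)).trans ?_
  rw [Subsingleton.elim (x ∘ Fin.natAdd (ar p)) default]
  rfl

open Classical in
/-- The expansion of a structure in which each new relation symbol `p` is interpreted by the
relation defined by `d p`. -/
@[reducible]
noncomputable def expandStructure {S S' : Set P}
    (d : (p : P) → p ∈ S' → p ∉ S → (Lang ar S).Formula (Fin (ar p)))
    (M : Type) [(Lang ar S).Structure M] : (Lang ar S').Structure M where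
  funMap f _ := f.elim
  RelMap r x :=
    if hr : r.1 ∈ S then Structure.RelMap (L := Lang ar S) ⟨r.1, hr, r.2.2⟩ x
    else (d r.1 r.2.1 hr).Realize (x ∘ Fin.cast r.2.2)

/-- Every model of a theory expands to a model of any definitional extension of it. -/
lemma DefExt.exists_expansion {T T' : STheory P ar} (hT : DefExt T T') (M : Type) [Nonempty M]
    [(Lang ar T.sig).Structure M] (hM : M ⊨ T.th) :
    ∃ (h : T.sig ⊆ T'.sig) (_ : (Lang ar T'.sig).Structure M),
      (langIncl (ar := ar) h).IsExpansionOn M ∧ M ⊨ T'.th := by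
  obtain ⟨h, Δ, ⟨d, rfl⟩, hequiv⟩ := hT
  let inst := expandStructure d M
  have hexp : (langIncl (ar := ar) h).IsExpansionOn M :=
    ⟨fun f => f.elim, fun r _ => dif_pos (c := r.1 ∈ T.sig) r.2.1⟩
  refine ⟨h, inst, hexp, (hequiv M).1 (Theory.model_union_iff.2
    ⟨(LHom.onTheory_model _ _).2 hM, ⟨?_⟩⟩)⟩
  rintro _ ⟨p, hp, hn, rfl⟩
  rw [realize_explicitDef]
  intro x
  rw [LHom.realize_onFormula]
  exact iff_of_eq (dif_neg hn)

/-- Every model of a definitional extension of a theory is a model of that theory. -/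
lemma DefExt.model_onTheory {T T' : STheory P ar} (hT : DefExt T T') (M : Type) [Nonempty M]
    [(Lang ar T'.sig).Structure M] (hM : M ⊨ T'.th) :
    ∃ h : T.sig ⊆ T'.sig, M ⊨ (langIncl (ar := ar) h).onTheory T.th := by
  obtain ⟨h, Δ, -, hequiv⟩ := hT
  exact ⟨h, (Theory.model_union_iff.1 ((hequiv M).2 hM)).1⟩

end Realization

section Unary

variable {S : Set P2} (M : Type) [(Lang ar2 S).Structure M]

lemma realize_exUnique [Subsingleton M] [Nonempty M] : M ⊨ exUnique S := by
  simpa [exUnique, Sentence.Realize, Formula.Realize] using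
    ⟨Classical.arbitrary M, fun _ => Subsingleton.elim _ _⟩

lemma realize_allRel {p : P2} (hp : p ∈ S) :
    M ⊨ allRel p hp ↔
      ∀ x : Fin 1 → M, Structure.RelMap (L := Lang ar2 S) (n := 1) ⟨p, hp, rfl⟩ x := by
  refine BoundedFormula.realize_all.trans
    ⟨fun H x => ?_, fun H a => BoundedFormula.realize_rel.2 (H _)⟩
  convert BoundedFormula.realize_rel.1 (H (x 0)) using 1
  funext i
  rw [Subsingleton.elim i 0]
  rfl

lemma realize_allNotRel {p : P2} (hp : p ∈ S) :
    M ⊨ allNotRel p hp ↔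
      ∀ x : Fin 1 → M, ¬ Structure.RelMap (L := Lang ar2 S) (n := 1) ⟨p, hp, rfl⟩ x := by
  refine BoundedFormula.realize_all.trans
    ⟨fun H x hx => H (x 0) (BoundedFormula.realize_rel.2 ?_),
      fun H a ha => H _ (BoundedFormula.realize_rel.1 ha)⟩
  convert hx using 1
  funext i
  rw [Subsingleton.elim i 0]
  rfl

end Unary

lemma realize_explicitDef_top {S S' : Set P2} (h : S ⊆ S') {p : P2} (hp : p ∈ S')
    (M : Type) [(Lang ar2 S').Structure M] :
    M ⊨ explicitDef (ar := ar2) h hp ⊤ ↔ M ⊨ allRel p hp := by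
  rw [realize_explicitDef, realize_allRel]
  exact forall_congr' fun x => iff_true_right id

lemma realize_explicitDef_bot {S S' : Set P2} (h : S ⊆ S') {p : P2} (hp : p ∈ S')
    (M : Type) [(Lang ar2 S').Structure M] :
    M ⊨ explicitDef (ar := ar2) h hp ⊥ ↔ M ⊨ allNotRel p hp := by
  rw [realize_explicitDef, realize_allNotRel]
  exact forall_congr' fun x => iff_false_right id

/-- A theory in the signature `S` extends definitionally to the full signature `{p, q}` by
`ψ`, when `S` lacks exactly the symbol `r` and `ψ` is equivalent to an explicit definition
of `r`. -/
lemma defExt_univ {S : Set P2} {r : P2} (hr : ∀ p, p ∉ S ↔ p = r) (T : (Lang ar2 S).Theory)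
    (φ : (Lang ar2 S).Formula (Fin 1)) (ψ : (Lang ar2 Set.univ).Sentence)
    (hψ : ∀ (M : Type) [(Lang ar2 Set.univ).Structure M],
      M ⊨ explicitDef (ar := ar2) (p := r) (Set.subset_univ S) trivial φ ↔ M ⊨ ψ)
    {T₀ T' : (Lang ar2 Set.univ).Theory} (hT : (langIncl (Set.subset_univ S)).onTheory T = T₀)
    (hT' : T' = T₀ ∪ {ψ}) :
    DefExt ⟨S, T⟩ ⟨Set.univ, T'⟩ := by
  refine ⟨Set.subset_univ S, {explicitDef (p := r) (Set.subset_univ S) trivial φ},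
    ⟨fun _ _ _ => φ, ?_⟩, fun M _ _ => ?_⟩
  · ext σ
    constructor
    · rintro rfl
      exact ⟨r, trivial, (hr r).2 rfl, rfl⟩
    · rintro ⟨p, hp, hn, rfl⟩
      obtain rfl := (hr p).1 hn
      rfl
  · subst hT' hT
    rw [Theory.model_union_iff, Theory.model_union_iff, Theory.model_singleton_iff,
      Theory.model_singleton_iff, hψ]

lemma notMem_sigP (p : P2) : p ∉ sigP ↔ p = 1 := by
  unfold sigP
  fin_cases p <;> simp

lemma notMem_sigQ (p : P2) : p ∉ sigQ ↔ p = 0 := by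
  unfold sigQ
  fin_cases p <;> simp

section LangIncl

variable {S S' : Set P2} (h : S ⊆ S')

lemma onSentence_exUnique : (langIncl h).onSentence (exUnique S) = exUnique S' :=
  rfl

lemma onBoundedFormula_rel_var {p : P2} (hp : p ∈ S) :
    (langIncl h).onBoundedFormula (Relations.boundedFormula₁ (α := Empty) (n := 1)
      (⟨p, hp, rfl⟩ : (Lang ar2 S).Relations 1) (Term.var (Sum.inr 0))) =
    Relations.boundedFormula₁ (⟨p, h hp, rfl⟩ : (Lang ar2 S').Relations 1)
      (Term.var (Sum.inr 0)) :=
  congrArg (BoundedFormula.rel _) (funext fun i => by rw [Subsingleton.elim i 0]; rfl)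

lemma onSentence_allRel {p : P2} (hp : p ∈ S) :
    (langIncl h).onSentence (allRel p hp) = allRel p (h hp) :=
  congrArg BoundedFormula.all (onBoundedFormula_rel_var h hp)

lemma onSentence_allNotRel {p : P2} (hp : p ∈ S) :
    (langIncl h).onSentence (allNotRel p hp) = allNotRel p (h hp) :=
  congrArg (fun φ => BoundedFormula.all (∼φ)) (onBoundedFormula_rel_var h hp)

lemma onTheory_allRel {p : P2} (hp : p ∈ S) :
    (langIncl h).onTheory {exUnique S, allRel p hp} = {exUnique S', allRel p (h hp)} := by
  rw [← onSentence_exUnique h, ← onSentence_allRel h hp]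
  exact Set.image_pair _ _ _

lemma onTheory_allNotRel {p : P2} (hp : p ∈ S) :
    (langIncl h).onTheory {exUnique S, allNotRel p hp} = {exUnique S', allNotRel p (h hp)} := by
  rw [← onSentence_exUnique h, ← onSentence_allNotRel h hp]
  exact Set.image_pair _ _ _

end LangIncl

lemma mergeable_Th1_Th3 : Mergeable Th1 Th3 := by
  refine ⟨⟨Set.univ, {exUnique Set.univ, allRel 0 (Set.mem_univ 0), allRel 1 (Set.mem_univ 1)}⟩,
    defExt_univ notMem_sigP _ ⊤ (allRel 1 (Set.mem_univ 1))
      (fun M _ => realize_explicitDef_top _ _ M) (onTheory_allRel _ _) ?_,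
    defExt_univ notMem_sigQ _ ⊤ (allRel 0 (Set.mem_univ 0))
      (fun M _ => realize_explicitDef_top _ _ M) (onTheory_allRel _ _) ?_⟩
  · rw [Set.insert_union, Set.singleton_union]
  · rw [Set.insert_union, Set.singleton_union, Set.pair_comm (allRel 0 (Set.mem_univ 0))]

lemma mergeable_Th3_Th2 : Mergeable Th3 Th2 := by
  refine ⟨⟨Set.univ, {exUnique Set.univ, allNotRel 0 (Set.mem_univ 0), allRel 1 (Set.mem_univ 1)}⟩,
    defExt_univ notMem_sigQ _ ⊥ (allNotRel 0 (Set.mem_univ 0))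
      (fun M _ => realize_explicitDef_bot _ _ M) (onTheory_allRel _ _) ?_,
    defExt_univ notMem_sigP _ ⊤ (allRel 1 (Set.mem_univ 1))
      (fun M _ => realize_explicitDef_top _ _ M) (onTheory_allNotRel _ _) ?_⟩
  · rw [Set.insert_union, Set.singleton_union,
      Set.pair_comm (allNotRel 0 (Set.mem_univ 0))]
  · rw [Set.insert_union, Set.singleton_union]

lemma not_mergeable_Th1_Th2 : ¬ Mergeable Th1 Th2 := by
  rintro ⟨T', h₁, h₂⟩
  let _ : (Lang ar2 Th1.sig).Structure Unit :=
    { funMap := fun f _ => f.elim, RelMap := fun _ _ => True }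
  have hM : Unit ⊨ Th1.th := by
    refine ⟨?_⟩
    rintro _ (rfl | rfl)
    · exact realize_exUnique (S := Th1.sig) Unit
    · exact (realize_allRel (S := Th1.sig) Unit _).2 fun _ => trivial
  obtain ⟨h, _, hexp, hT'⟩ := DefExt.exists_expansion (T := Th1) h₁ Unit hM
  obtain ⟨h', hTh2⟩ := h₂.model_onTheory Unit hT'
  have hneg : Unit ⊨ allNotRel (S := T'.sig) 0 (h' rfl) :=
    hTh2.realize_of_mem _ ⟨_, Or.inr rfl, onSentence_allNotRel h' rfl⟩
  refine (realize_allNotRel Unit _).1 hneg (fun _ => ()) ?_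
  exact (iff_of_eq (hexp.map_onRelation
    (n := 1) ⟨0, rfl, rfl⟩ fun _ => ())).2 trivial

/-- Theorem 1: definitional mergeability is not transitive, hence it is not an
equivalence relation: `T₁ ⋈ T₃` and `T₃ ⋈ T₂`, but `T₁` and `T₂` are not
definitionally mergeable. -/
theorem mergeable_not_transitive :
    Mergeable Th1 Th3 ∧ Mergeable Th3 Th2 ∧ ¬ Mergeable Th1 Th2 ∧
    ¬ Transitive (fun T T' : STheory P2 ar2 => Mergeable T T') ∧
    ¬ Equivalence (fun T T' : STheory P2 ar2 => Mergeable T T') := by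
  have not_trans : ¬ Transitive (fun T T' : STheory P2 ar2 => Mergeable T T') := fun h =>
    not_mergeable_Th1_Th2 (h mergeable_Th1_Th3 mergeable_Th3_Th2)
  exact ⟨mergeable_Th1_Th3, mergeable_Th3_Th2, not_mergeable_Th1_Th2, not_trans,
    fun h => not_trans fun _ _ _ => h.trans⟩

end DefEqPaper
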